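/- (L₁ truncation error of a GLMB.) Let 𝔻 ⊆ ℂ be finite index sets, and for a finite index set 𝕀 let f_𝕀(X) = Δ(X) ∑_{c∈𝕀} w^(c)(L(X)) [p^(c)]^X be the (possibly unnormalized) GLMB density obtained by keeping the components indexed by 𝕀, where each p^(c)(·,ℓ) is a probability density on 𝕏 and the weights w^(c)(L) are nonnegative with ∑_{c∈ℂ} ∑_{L⊆𝕃} w^(c)(L) < ∞. Then the L₁-norm of the truncation error, defined as the set integral ∫ |f_ℂ(X) − f_𝔻(X)| δX over all finite subsets of 𝕏×𝕃, equals the total weight of the discarded components: ‖f_ℂ − f_𝔻‖₁ = ∑_{c∈ℂ∖𝔻} ∑_{L⊆𝕃} w^(c)(L). -/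

import Mathlib

open MeasureTheory ENNReal

open Function Finset in
/-- The tuples that enumerate `J` without repetition are the bijections `Fin n ≃ J`. -/
def injectiveImageEquiv {L : Type*} [DecidableEq L] (n : ℕ) (J : Finset L) :
    {l : Fin n → L // Injective l ∧ image l univ = J} ≃ {f : Fin n → J // Bijective f} where
  toFun l := ⟨fun i => ⟨l.1 i, l.2.2.subset (mem_image_of_mem _ (mem_univ i))⟩,
    fun a b h => l.2.1 (congrArg Subtype.val h), fun ⟨y, hy⟩ => by
      obtain ⟨i, -, hi⟩ := mem_image.1 (l.2.2.symm ▸ hy : y ∈ image l.1 univ)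
      exact ⟨i, Subtype.ext hi⟩⟩
  invFun f := ⟨fun i => f.1 i, Subtype.val_injective.comp f.2.1, by
    ext y
    simp only [mem_image, mem_univ, true_and]
    constructor
    · rintro ⟨i, rfl⟩
      exact (f.1 i).2
    · intro hy
      obtain ⟨i, hi⟩ := f.2.2 ⟨y, hy⟩
      exact ⟨i, by rw [hi]⟩⟩
  left_inv _ := rfl
  right_inv _ := rfl

open Function Finset in
theorem encard_injective_image_eq {L : Type*} [DecidableEq L] (n : ℕ) (J : Finset L) :
    {l : Fin n → L | Injective l ∧ image l univ = J}.encard =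
      if #J = n then (n.factorial : ℕ∞) else 0 := by
  split_ifs with h
  · have e : Fin n ≃ J := (finCongr h.symm).trans J.equivFin.symm
    rw [← ENat.card_coe_set_eq]
    refine (ENat.card_congr ((injectiveImageEquiv n J).trans Equiv.bijectiveEquiv)).trans ?_
    rw [ENat.card_eq_coe_fintype_card, Fintype.card_equiv e, Fintype.card_fin]
  · rw [Set.encard_eq_zero, Set.eq_empty_iff_forall_notMem]
    rintro l ⟨hl, rfl⟩
    exact h (by simp [card_image_of_injective _ hl])

open Function Finset in
theorem tsum_injective_image {L : Type*} [DecidableEq L] (g : Finset L → ℝ≥0∞) (n : ℕ) :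
    ∑' l : Fin n → L, (if Injective l then g (image l univ) else 0) =
      ∑' J : Finset L, if #J = n then (n.factorial : ℝ≥0∞) * g J else 0 := by
  have h (l : Fin n → L) : (if Injective l then g (image l univ) else 0) =
      ∑' J : Finset L, {l : Fin n → L | Injective l ∧ image l univ = J}.indicator
        (fun _ => g J) l := by
    rw [tsum_eq_single (image l univ)]
    · simp [Set.indicator_apply]
    · intro J hJ
      simp [hJ.symm]
  simp_rw [h]
  rw [ENNReal.tsum_comm]
  refine tsum_congr fun J => ?_
  rw [← _root_.tsum_subtype, ENNReal.tsum_set_const, encard_injective_image_eq]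
  split_ifs <;> simp

open Function Finset in
/-- The set integral over labels of a function of the label set alone is its sum over finite
label sets. -/
theorem tsum_factorial_inv_mul_tsum_injective_image {L : Type*} [DecidableEq L]
    (g : Finset L → ℝ≥0∞) :
    ∑' n : ℕ, (n.factorial : ℝ≥0∞)⁻¹ *
      ∑' l : Fin n → L, (if Injective l then g (image l univ) else 0) = ∑' J, g J := by
  simp_rw [tsum_injective_image, ← ENNReal.tsum_mul_left]
  rw [ENNReal.tsum_comm]
  refine tsum_congr fun J => ?_
  rw [tsum_eq_single #J (fun n hn => by simp [hn.symm]), if_pos rfl, ← mul_assoc,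
    ENNReal.inv_mul_cancel (by exact_mod_cast Nat.factorial_ne_zero _)
      (ENNReal.natCast_ne_top _), one_mul]

/-- **Tonelli's theorem** for a product of functions of the separate coordinates. -/
theorem lintegral_fin_prod_eq_prod {E : Type*} [MeasureSpace E]
    [SigmaFinite (volume : Measure E)] {n : ℕ} (f : Fin n → E → ℝ≥0∞)
    (hf : ∀ i, Measurable (f i)) :
    ∫⁻ x : Fin n → E, ∏ i, f i (x i) = ∏ i, ∫⁻ x, f i x := by
  induction n with
  | zero => simp [volume_pi]
  | succ n ih =>
    have e := volume_preserving_piFinSuccAbove (fun _ : Fin (n + 1) => E) 0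
    have hm : Measurable fun y : Fin n → E => ∏ i : Fin n, f i.succ (y i) :=
      Finset.measurable_prod _ fun i _ => (hf i.succ).comp (measurable_pi_apply i)
    rw [Fin.prod_univ_succ, ← ih (fun i => f i.succ) fun i => hf i.succ,
      ← lintegral_prod_mul (hf 0).aemeasurable hm.aemeasurable]
    refine Eq.trans ?_ (e.lintegral_comp (((hf 0).comp measurable_fst).mul
      (hm.comp measurable_snd)))
    refine lintegral_congr fun x => ?_
    rw [Fin.prod_univ_succ]
    rfl

theorem lintegral_ofReal_sum_mul_prod {E L ι : Type*} [MeasureSpace E]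
    [SigmaFinite (volume : Measure E)] {n : ℕ} (S : Finset ι) (a : ι → ℝ)
    (ha : ∀ c, 0 ≤ a c) (p : ι → E → L → ℝ) (hp0 : ∀ c x ℓ, 0 ≤ p c x ℓ)
    (hpm : ∀ c ℓ, Measurable fun x => p c x ℓ)
    (hp1 : ∀ c ℓ, ∫⁻ x, ENNReal.ofReal (p c x ℓ) = 1) (l : Fin n → L) :
    ∫⁻ xs : Fin n → E, ENNReal.ofReal (∑ c ∈ S, a c * ∏ i, p c (xs i) (l i)) =
      ∑ c ∈ S, ENNReal.ofReal (a c) := by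
  have h (xs : Fin n → E) : ENNReal.ofReal (∑ c ∈ S, a c * ∏ i, p c (xs i) (l i)) =
      ∑ c ∈ S, ENNReal.ofReal (a c) * ∏ i, ENNReal.ofReal (p c (xs i) (l i)) := by
    rw [ENNReal.ofReal_sum_of_nonneg fun c _ =>
      mul_nonneg (ha c) (Finset.prod_nonneg fun i _ => hp0 _ _ _)]
    refine Finset.sum_congr rfl fun c _ => ?_
    rw [ENNReal.ofReal_mul (ha c), ENNReal.ofReal_prod_of_nonneg fun i _ => hp0 _ _ _]
  have hm (c : ι) : Measurable fun xs : Fin n → E =>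
      ∏ i, ENNReal.ofReal (p c (xs i) (l i)) :=
    Finset.measurable_prod _ fun i _ =>
      ((hpm c (l i)).comp (measurable_pi_apply i)).ennreal_ofReal
  simp_rw [h]
  rw [lintegral_finsetSum _ fun c _ => (hm c).const_mul _]
  refine Finset.sum_congr rfl fun c _ => ?_
  rw [lintegral_const_mul _ (hm c), lintegral_fin_prod_eq_prod (fun i x => ENNReal.ofReal (p c x (l i)))
      fun i => (hpm c (l i)).ennreal_ofReal]
  simp [hp1]

/-- L₁ truncation error of a GLMB.  For finite index sets
`𝔻 ⊆ ℂ` and the (possibly unnormalized) GLMB densities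
`f_𝕀(X) = Δ(X) ∑_{c∈𝕀} w⁽ᶜ⁾(L(X)) [p⁽ᶜ⁾]^X`, the L₁-norm of the truncation
error equals the total weight of the discarded components:
`‖f_ℂ − f_𝔻‖₁ = ∑_{c∈ℂ∖𝔻} ∑_{L⊆𝕃} w⁽ᶜ⁾(L)`. -/
theorem glmb_truncation_L1_error
    {d : ℕ} {L ι : Type*} [Countable L] [DecidableEq L] [DecidableEq ι]
    (C D : Finset ι) (hDC : D ⊆ C)
    (w : ι → Finset L → ℝ) (hw : ∀ c J, 0 ≤ w c J)
    (p : ι → (Fin d → ℝ) → L → ℝ)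
    (hp0 : ∀ c x ℓ, 0 ≤ p c x ℓ)
    (hpm : ∀ c ℓ, Measurable fun x => p c x ℓ)
    (hp1 : ∀ c ℓ, ∫⁻ x, ENNReal.ofReal (p c x ℓ) = 1)
    (hwsum : ∀ c ∈ C, Summable fun J : Finset L => w c J) :
    ∑' n : ℕ, (Nat.factorial n : ℝ≥0∞)⁻¹ *
      ∑' ℓs : Fin n → L,
        ∫⁻ xs : Fin n → (Fin d → ℝ),
          ENNReal.ofReal
            |((if Function.Injective ℓs then (1:ℝ) else 0) *
                ∑ c ∈ C, w c (Finset.image ℓs Finset.univ) * ∏ i, p c (xs i) (ℓs i)) -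
             ((if Function.Injective ℓs then (1:ℝ) else 0) *
                ∑ c ∈ D, w c (Finset.image ℓs Finset.univ) * ∏ i, p c (xs i) (ℓs i))|
    = ENNReal.ofReal (∑ c ∈ C \ D, ∑' J : Finset L, w c J) := by
  have key (n : ℕ) (ℓs : Fin n → L) : (∫⁻ xs : Fin n → (Fin d → ℝ),
          ENNReal.ofReal
            |((if Function.Injective ℓs then (1:ℝ) else 0) *
                ∑ c ∈ C, w c (Finset.image ℓs Finset.univ) * ∏ i, p c (xs i) (ℓs i)) -
             ((if Function.Injective ℓs then (1:ℝ) else 0) *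
                ∑ c ∈ D, w c (Finset.image ℓs Finset.univ) * ∏ i, p c (xs i) (ℓs i))|) =
      if Function.Injective ℓs then
        ∑ c ∈ C \ D, ENNReal.ofReal (w c (Finset.image ℓs Finset.univ)) else 0 := by
    split_ifs
    · rw [← lintegral_ofReal_sum_mul_prod _ (fun c => w c (Finset.image ℓs Finset.univ))
        (fun c => hw c _) p hp0 hpm hp1 ℓs]
      refine lintegral_congr fun xs => ?_
      rw [one_mul, one_mul, ← Finset.sum_sdiff hDC, add_sub_cancel_right, abs_of_nonneg]
      exact Finset.sum_nonneg fun c _ =>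
        mul_nonneg (hw _ _) (Finset.prod_nonneg fun i _ => hp0 _ _ _)
    · simp
  simp_rw [key]
  rw [tsum_factorial_inv_mul_tsum_injective_image
      (fun J => ∑ c ∈ C \ D, ENNReal.ofReal (w c J)),
    Summable.tsum_finsetSum fun c _ => ENNReal.summable,
    ENNReal.ofReal_sum_of_nonneg fun c _ => tsum_nonneg (hw c)]
  exact Finset.sum_congr rfl fun c hc =>
    (ENNReal.ofReal_tsum_of_nonneg (hw c) (hwsum c (Finset.mem_sdiff.1 hc).1)).symm
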